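/- arXiv:1406.4584 — 2 statements merged into one kernel-verified Lean document; each statement's English description precedes it below -/
import Mathlib

section
/- Let A be a Schur-stable m×m real matrix and let M be a symmetric positive semidefinite m×m real matrix. If V and W are m×m real matrices each satisfying the Riccati equation, i.e. V = A (V + M) Aᵀ and W = A (W + M) Aᵀ, then V = W. -/
open Matrix

/-- An `m × m` real matrix is Schur-stable if every eigenvalue of it,
regarded as a matrix over `ℂ`, has modulus strictly less than `1`. -/
def SchurStable {m : ℕ} (A : Matrix (Fin m) (Fin m) ℝ) : Prop :=
  ∀ μ ∈ spectrum ℂ (A.map Complex.ofReal), ‖μ‖ < 1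

open Filter Topology

/-- In a complex Banach algebra, the powers of an element of spectral radius less than `1`
tend to `0`. -/
theorem tendsto_pow_zero_of_spectralRadius_lt_one {B : Type*} [NormedRing B]
    [NormedAlgebra ℂ B] [CompleteSpace B] {a : B} (ha : spectralRadius ℂ a < 1) :
    Tendsto (fun n : ℕ => a ^ n) atTop (𝓝 0) := by
  obtain ⟨r, har, hr⟩ := ENNReal.lt_iff_exists_nnreal_btwn.mp ha
  have hr1 : r < 1 := by exact_mod_cast hr
  have hev : ∀ᶠ n : ℕ in atTop, ‖a ^ n‖ ≤ (r : ℝ) ^ n := by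
    have hlim := spectrum.pow_nnnorm_pow_one_div_tendsto_nhds_spectralRadius a
    filter_upwards [hlim.eventually_lt_const har,
      eventually_gt_atTop 0] with n hn hn0
    have hpow := ENNReal.rpow_le_rpow hn.le (Nat.cast_nonneg n : (0 : ℝ) ≤ n)
    rw [← ENNReal.rpow_mul, one_div_mul_cancel (by positivity), ENNReal.rpow_one,
      ENNReal.rpow_natCast] at hpow
    exact_mod_cast hpow
  exact squeeze_zero_norm' hev
    (tendsto_pow_atTop_nhds_zero_of_lt_one r.coe_nonneg (by exact_mod_cast hr1))

/-- A complex matrix whose eigenvalues all have modulus less than `1` has powers tending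
to `0`. -/
theorem Matrix.tendsto_pow_zero_of_forall_spectrum_norm_lt_one {n : Type*} [Fintype n]
    [DecidableEq n] {A : Matrix n n ℂ} (hA : ∀ μ ∈ spectrum ℂ A, ‖μ‖ < 1) :
    Tendsto (fun k : ℕ => A ^ k) atTop (𝓝 0) := by
  let _ : NormedRing (Matrix n n ℂ) := Matrix.linftyOpNormedRing
  let _ : NormedAlgebra ℂ (Matrix n n ℂ) := Matrix.linftyOpNormedAlgebra
  rcases subsingleton_or_nontrivial (Matrix n n ℂ) with h | h
  · exact tendsto_const_nhds.congr fun _ => Subsingleton.elim _ _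
  · have : CompleteSpace (Matrix n n ℂ) := FiniteDimensional.complete ℂ _
    refine tendsto_pow_zero_of_spectralRadius_lt_one ?_
    exact_mod_cast spectrum.spectralRadius_lt_of_forall_lt A (r := 1)
      fun μ hμ => by exact_mod_cast hA μ hμ

/-- The homogeneous Stein equation `D = A D Aᵀ` has only the trivial solution when the powers
of `A` tend to `0`. -/
theorem Matrix.eq_zero_of_eq_mul_mul_transpose {n R : Type*} [Fintype n] [DecidableEq n]
    [CommRing R] [TopologicalSpace R] [IsTopologicalRing R] [T2Space R] {A D : Matrix n n R}
    (hA : Tendsto (fun k : ℕ => A ^ k) atTop (𝓝 0)) (hD : D = A * D * Aᵀ) : D = 0 := by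
  have hpow : ∀ k : ℕ, A ^ k * D * (A ^ k)ᵀ = D := by
    intro k
    induction k with
    | zero => simp
    | succ k ih =>
      calc A ^ (k + 1) * D * (A ^ (k + 1))ᵀ = A ^ k * (A * D * Aᵀ) * (A ^ k)ᵀ := by
            rw [pow_succ, transpose_mul]; simp only [Matrix.mul_assoc]
        _ = D := by rw [← hD, ih]
  have hcont : Continuous fun X : Matrix n n R => X * D * Xᵀ := by fun_prop
  have hlim := (hcont.tendsto 0).comp hA
  simp only [Function.comp_def, hpow, Matrix.zero_mul] at hlim
  exact tendsto_nhds_unique tendsto_const_nhds hlim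

theorem riccati_solution_unique {m : ℕ} (A M V W : Matrix (Fin m) (Fin m) ℝ)
    (hA : SchurStable A) (hM : M.PosSemidef)
    (hV : V = A * (V + M) * Aᵀ) (hW : W = A * (W + M) * Aᵀ) :
    V = W := by
  have hD : V - W = A * (V - W) * Aᵀ := by
    conv_lhs => rw [hV, hW]
    noncomm_ring
  have hmap : (V - W).map Complex.ofRealHom =
      A.map Complex.ofRealHom * (V - W).map Complex.ofRealHom * (A.map Complex.ofRealHom)ᵀ := by
    conv_lhs => rw [hD]
    rw [Matrix.map_mul, Matrix.map_mul, transpose_map]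
  have hzero := Matrix.eq_zero_of_eq_mul_mul_transpose
    (Matrix.tendsto_pow_zero_of_forall_spectrum_norm_lt_one hA) hmap
  ext i j
  have hij := congrFun (congrFun hzero i) j
  simpa [sub_eq_zero] using hij
end

section
/- Let A₁, …, A_k be m×m real matrices, let A = (A₁, …, A_k) denote the m×mk matrix of coefficients, and let Ã be the companion matrix. The matrix polynomial A(z) = z^k·1_m − A₁ z^{k−1} − ⋯ − A_k is Schur-stable if and only if there exists a positive definite symmetric block Toeplitz matrix U_{k−1} of order k−1 (with m×m blocks U(0), …, U(k−1)) such that the generalized Stein transform U_{k−1} − Ã U_{k−1} Ãᵀ is positive semidefinite and its top-left m×m block U(0) − A U_{k−1} Aᵀ is positive definite. -/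
open Matrix

/-- The symmetric block Toeplitz matrix with `n` block rows/columns built from the
blocks `U 0, U 1, …`: its `(i,j)` block is `U (j-i)` for `i ≤ j` and `U (i-j)ᵀ` for `i > j`. -/
def blockToeplitz {m : ℕ} (U : ℕ → Matrix (Fin m) (Fin m) ℝ) (n : ℕ) :
    Matrix (Fin n × Fin m) (Fin n × Fin m) ℝ :=
  Matrix.of fun p q =>
    if p.1.val ≤ q.1.val then U (q.1.val - p.1.val) p.2 q.2
    else U (p.1.val - q.1.val) q.2 p.2

/-- `ξ_tᵀ = (U(1), …, U(t))`, an `m × mt` matrix. -/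
def xiT {m : ℕ} (U : ℕ → Matrix (Fin m) (Fin m) ℝ) (t : ℕ) :
    Matrix (Fin m) (Fin t × Fin m) ℝ :=
  Matrix.of fun r q => U (q.1.val + 1) r q.2

/-- `κ_tᵀ = (U(t)ᵀ, …, U(1)ᵀ)`, an `m × mt` matrix. -/
def kappaT {m : ℕ} (U : ℕ → Matrix (Fin m) (Fin m) ℝ) (t : ℕ) :
    Matrix (Fin m) (Fin t × Fin m) ℝ :=
  Matrix.of fun r q => U (t - q.1.val) q.2 r

/-- The Schur complement `C_t = U(0) - ξ_tᵀ U_{t-1}⁻¹ ξ_t` (with `C_0 = U(0)`). -/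
noncomputable def schurC {m : ℕ} (U : ℕ → Matrix (Fin m) (Fin m) ℝ) (t : ℕ) :
    Matrix (Fin m) (Fin m) ℝ :=
  U 0 - xiT U t * (blockToeplitz U t)⁻¹ * (xiT U t)ᵀ

/-- The Schur complement `D_t = U(0) - κ_tᵀ U_{t-1}⁻¹ κ_t` (with `D_0 = U(0)`). -/
noncomputable def schurD {m : ℕ} (U : ℕ → Matrix (Fin m) (Fin m) ℝ) (t : ℕ) :
    Matrix (Fin m) (Fin m) ℝ :=
  U 0 - kappaT U t * (blockToeplitz U t)⁻¹ * (kappaT U t)ᵀ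

/-- The `m × mk` coefficient matrix `(A₁, …, A_k)`. -/
def coeffRow {m k : ℕ} (A : Fin k → Matrix (Fin m) (Fin m) ℝ) :
    Matrix (Fin m) (Fin k × Fin m) ℝ :=
  Matrix.of fun r q => A q.1 r q.2

/-- The `mk × mk` companion matrix of `A₁, …, A_k`: first block row `(A₁, …, A_k)`,
identity blocks on the subdiagonal, zeros elsewhere. -/
def companion {m k : ℕ} (A : Fin k → Matrix (Fin m) (Fin m) ℝ) :
    Matrix (Fin k × Fin m) (Fin k × Fin m) ℝ :=
  Matrix.of fun p q =>
    if p.1.val = 0 then A q.1 p.2 q.2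
    else if p.1.val = q.1.val + 1 then (1 : Matrix (Fin m) (Fin m) ℝ) p.2 q.2
    else 0

/-- The matrix polynomial `A(z) = z^k 1_m - A₁ z^{k-1} - ⋯ - A_k` is Schur-stable if
every complex root of `det A(z) = 0` has modulus strictly less than one. -/
def SchurStablePoly {m k : ℕ} (A : Fin k → Matrix (Fin m) (Fin m) ℝ) : Prop :=
  ∀ z : ℂ,
    (z ^ k • (1 : Matrix (Fin m) (Fin m) ℂ) -
        ∑ i : Fin k, z ^ (k - 1 - i.val) • (A i).map Complex.ofReal).det = 0 →
    ‖z‖ < 1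

open Filter
open scoped NNReal ENNReal

section PowerDecay

theorem summable_norm_pow_sq_of_spectrum {𝔸 : Type*} [NormedRing 𝔸] [NormedAlgebra ℂ 𝔸]
    [CompleteSpace 𝔸] (a : 𝔸) (ha : ∀ z ∈ spectrum ℂ a, ‖z‖ < 1) :
    Summable fun n : ℕ => ‖a ^ n‖ ^ 2 := by
  rcases subsingleton_or_nontrivial 𝔸 with h | h
  · have h0 : (fun n : ℕ => ‖a ^ n‖ ^ 2) = fun _ => 0 := by
      funext n
      rw [Subsingleton.elim (a ^ n) 0]
      simp
    rw [h0]
    exact summable_zero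
  · have hρ : spectralRadius ℂ a < ((1 : ℝ≥0) : ℝ≥0∞) :=
      spectrum.spectralRadius_lt_of_forall_lt a fun z hz => ha z hz
    obtain ⟨r, hr, hr1⟩ := ENNReal.lt_iff_exists_nnreal_btwn.1 hρ
    have hr1' : r < 1 := ENNReal.coe_lt_coe.1 hr1
    have hev := (spectrum.pow_nnnorm_pow_one_div_tendsto_nhds_spectralRadius a).eventually_lt_const
      hr
    refine Summable.of_norm_bounded_eventually_nat
      (g := fun n => ((r : ℝ) ^ 2) ^ n)
      (summable_geometric_of_lt_one (by positivity) ?_) ?_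
    · exact pow_lt_one₀ r.coe_nonneg (by exact_mod_cast hr1') two_ne_zero
    · filter_upwards [hev, eventually_gt_atTop 0] with n hn hn0
      have hn' : (‖a ^ n‖₊ : ℝ≥0∞) ≤ (r : ℝ≥0∞) ^ n := by
        have := ENNReal.rpow_le_rpow hn.le (Nat.cast_nonneg (α := ℝ) n)
        rw [← ENNReal.rpow_mul, one_div_mul_cancel (by positivity), ENNReal.rpow_one,
          ENNReal.rpow_natCast] at this
        exact this
      have hn'' : ‖a ^ n‖ ≤ (r : ℝ) ^ n := by exact_mod_cast hn'
      rw [Real.norm_of_nonneg (by positivity), ← pow_mul, mul_comm 2 n, pow_mul]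
      gcongr

attribute [local instance] Matrix.frobeniusNormedRing Matrix.frobeniusNormedAlgebra in
/-- The discrete Lyapunov equation is solvable in positive semidefinite matrices when the
complex spectrum lies in the open unit disc. -/
theorem exists_posSemidef_stein {ι : Type*} [Fintype ι] [DecidableEq ι]
    (M Q : Matrix ι ι ℝ) (hM : ∀ z ∈ spectrum ℂ (M.map Complex.ofReal), ‖z‖ < 1)
    (hQ : Q.PosSemidef) :
    ∃ P : Matrix ι ι ℝ, P.PosSemidef ∧ P = Q + M * P * Mᵀ := by
  have hsum : Summable fun n : ℕ => ‖M ^ n‖ ^ 2 := by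
    refine (summable_norm_pow_sq_of_spectrum _ hM).congr fun n => ?_
    have : (M.map Complex.ofReal) ^ n = (M ^ n).map Complex.ofReal :=
      (Matrix.map_pow M Complex.ofRealHom n).symm
    rw [this, Matrix.frobenius_norm_map_eq _ _ fun x => by simp]
  let T : ℕ → Matrix ι ι ℝ := fun n => M ^ n * Q * (M ^ n)ᵀ
  have hT : Summable T := by
    refine Summable.of_norm_bounded (hsum.mul_right ‖Q‖) fun n => ?_
    calc ‖M ^ n * Q * (M ^ n)ᵀ‖ ≤ ‖M ^ n‖ * ‖Q‖ * ‖(M ^ n)ᵀ‖ :=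
          (norm_mul_le _ _).trans (by gcongr; exact norm_mul_le _ _)
      _ = ‖M ^ n‖ ^ 2 * ‖Q‖ := by rw [Matrix.frobenius_norm_transpose]; ring
  have hTpos : ∀ n, (T n).PosSemidef := fun n => by
    simpa [T] using hQ.mul_mul_conjTranspose_same (M ^ n)
  refine ⟨∑' n, T n, ?_, ?_⟩
  · refine Matrix.PosSemidef.of_dotProduct_mulVec_nonneg ?_ fun x => ?_
    · change (∑' n, T n)ᴴ = _
      rw [Matrix.conjTranspose_tsum]
      exact tsum_congr fun n => (hTpos n).isHermitian
    · let g : Matrix ι ι ℝ →+ ℝ :=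
        { toFun := fun N => star x ⬝ᵥ (N *ᵥ x)
          map_zero' := by simp
          map_add' := fun N N' => by rw [Matrix.add_mulVec, dotProduct_add] }
      have hg : Continuous g := by
        change Continuous fun N : Matrix ι ι ℝ => star x ⬝ᵥ (N *ᵥ x)
        fun_prop
      exact (hT.hasSum.map g hg).nonneg fun n => (hTpos n).dotProduct_mulVec_nonneg x
  · have hstep : ∀ n, T (n + 1) = M * T n * Mᵀ := fun n => by
      simp only [T, pow_succ', Matrix.transpose_mul, Matrix.mul_assoc]
    have h0 : T 0 = Q := by simp [T]
    conv_lhs => rw [hT.tsum_eq_zero_add, h0]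
    simp_rw [hstep]
    rw [(hT.mul_left M).tsum_mul_right, hT.tsum_mul_left]

end PowerDecay

section Companion

variable {m n : ℕ} (A : Fin (n + 1) → Matrix (Fin m) (Fin m) ℝ)

theorem companion_zero_apply (a : Fin m) (q : Fin (n + 1) × Fin m) :
    companion A (0, a) q = coeffRow A a q := by
  simp [companion, coeffRow]

theorem companion_succ_apply (i : Fin n) (a : Fin m) (q : Fin (n + 1) × Fin m) :
    companion A (i.succ, a) q = if (i.castSucc, a) = q then 1 else 0 := by
  obtain ⟨j, b⟩ := q
  simp only [companion, Matrix.of_apply, Fin.val_succ, Nat.succ_ne_zero, if_false,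
    Nat.add_right_cancel_iff, Prod.mk.injEq, Fin.ext_iff, Fin.val_castSucc, Matrix.one_apply]
  grind

theorem vecMul_companion_castSucc (x : Fin (n + 1) × Fin m → ℝ) (hx : ∀ a, x (0, a) = 0)
    (i : Fin n) (b : Fin m) :
    (x ᵥ* companion A) (i.castSucc, b) = x (i.succ, b) := by
  simp [Matrix.vecMul, dotProduct, Fintype.sum_prod_type, Fin.sum_univ_succ, hx,
    companion_succ_apply, ite_and]

theorem companion_conj_succ (P : Matrix (Fin (n + 1) × Fin m) (Fin (n + 1) × Fin m) ℝ)
    (i j : Fin n) (a b : Fin m) :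
    (companion A * P * (companion A)ᵀ) (i.succ, a) (j.succ, b) =
      P (i.castSucc, a) (j.castSucc, b) := by
  simp [Matrix.mul_apply, companion_succ_apply]

theorem companion_conj_zero (P : Matrix (Fin (n + 1) × Fin m) (Fin (n + 1) × Fin m) ℝ)
    (a b : Fin m) :
    (companion A * P * (companion A)ᵀ) (0, a) (0, b) =
      (coeffRow A * P * (coeffRow A)ᵀ) a b := by
  simp [Matrix.mul_apply, companion_zero_apply]

theorem companion_map_mulVec_zero (v : Fin (n + 1) × Fin m → ℂ) (a : Fin m) :
    ((companion A).map Complex.ofReal *ᵥ v) (0, a) =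
      ∑ j, ((A j).map Complex.ofReal *ᵥ fun b => v (j, b)) a := by
  simp [Matrix.mulVec, dotProduct, Fintype.sum_prod_type, companion_zero_apply, coeffRow]

theorem companion_map_mulVec_succ (v : Fin (n + 1) × Fin m → ℂ) (i : Fin n) (a : Fin m) :
    ((companion A).map Complex.ofReal *ᵥ v) (i.succ, a) = v (i.castSucc, a) := by
  simp [Matrix.mulVec, dotProduct, companion_succ_apply, apply_ite Complex.ofReal]

theorem mem_spectrum_iff_exists_mulVec {ι : Type*} [Fintype ι] [DecidableEq ι]
    (M : Matrix ι ι ℂ) (z : ℂ) : z ∈ spectrum ℂ M ↔ ∃ v ≠ 0, M *ᵥ v = z • v := by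
  rw [spectrum.mem_iff, Matrix.isUnit_iff_isUnit_det, isUnit_iff_ne_zero, not_not,
    ← Matrix.exists_mulVec_eq_zero_iff]
  simp [Matrix.sub_mulVec, Algebra.algebraMap_eq_smul_one, Matrix.smul_mulVec, sub_eq_zero, eq_comm]

theorem mem_spectrum_iff_exists_vecMul {ι : Type*} [Fintype ι] [DecidableEq ι]
    (M : Matrix ι ι ℂ) (z : ℂ) : z ∈ spectrum ℂ M ↔ ∃ v ≠ 0, v ᵥ* M = z • v := by
  rw [spectrum.mem_iff, Matrix.isUnit_iff_isUnit_det, isUnit_iff_ne_zero, not_not,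
    ← Matrix.exists_vecMul_eq_zero_iff]
  simp [Matrix.vecMul_sub, Algebra.algebraMap_eq_smul_one, Matrix.vecMul_smul, sub_eq_zero, eq_comm]

/-- The spectrum of the companion matrix consists of the roots of the matrix polynomial. -/
theorem mem_spectrum_companion_iff (z : ℂ) :
    z ∈ spectrum ℂ ((companion A).map Complex.ofReal) ↔
      (z ^ (n + 1) • (1 : Matrix (Fin m) (Fin m) ℂ) -
        ∑ i : Fin (n + 1), z ^ (n + 1 - 1 - i.val) • (A i).map Complex.ofReal).det = 0 := by
  rw [mem_spectrum_iff_exists_mulVec, ← Matrix.exists_mulVec_eq_zero_iff]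
  have key : ∀ u : Fin m → ℂ,
      (z ^ (n + 1) • (1 : Matrix (Fin m) (Fin m) ℂ) -
        ∑ i : Fin (n + 1), z ^ (n + 1 - 1 - i.val) • (A i).map Complex.ofReal) *ᵥ u = 0 ↔
      ∀ a, ∑ j : Fin (n + 1),
        ((A j).map Complex.ofReal *ᵥ fun b => z ^ (n - j.val) * u b) a = z ^ (n + 1) * u a := by
    intro u
    rw [Matrix.sub_mulVec, sub_eq_zero, funext_iff]
    refine forall_congr' fun a => ?_
    rw [Matrix.sum_mulVec, Finset.sum_apply, eq_comm, Matrix.smul_mulVec, Matrix.one_mulVec]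
    simp only [Matrix.smul_mulVec, Pi.smul_apply, smul_eq_mul, Nat.add_sub_cancel]
    have : ∀ j : Fin (n + 1), (fun b => z ^ (n - j.val) * u b) = z ^ (n - j.val) • u :=
      fun j => rfl
    simp only [this, Matrix.mulVec_smul, Pi.smul_apply, smul_eq_mul]
  constructor
  · rintro ⟨v, hv0, hv⟩
    have hv' : ∀ (i : Fin (n + 1)) (b : Fin m), v (i, b) = z ^ (n - i.val) * v (Fin.last n, b) := by
      intro i
      induction i using Fin.reverseInduction with
      | last => simp
      | cast i ih =>
        intro b
        have h := congrFun hv (i.succ, b)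
        rw [companion_map_mulVec_succ, Pi.smul_apply, ih, smul_eq_mul, ← mul_assoc, ← pow_succ'] at h
        rw [h, Fin.val_succ, Fin.val_castSucc]
        congr 2
        omega
    refine ⟨fun b => v (Fin.last n, b), fun h => hv0 ?_, (key _).2 fun a => ?_⟩
    · ext ⟨i, b⟩
      rw [hv', show v (Fin.last n, b) = 0 from congrFun h b, mul_zero, Pi.zero_apply]
    · have h := congrFun hv (0, a)
      rw [companion_map_mulVec_zero, Pi.smul_apply, hv' 0 a, smul_eq_mul, ← mul_assoc, Fin.val_zero,
        Nat.sub_zero, ← pow_succ'] at h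
      rw [← h]
      exact Finset.sum_congr rfl fun j _ => by simp only [← hv']
  · rintro ⟨u, hu0, hu⟩
    rw [key] at hu
    refine ⟨fun p => z ^ (n - p.1.val) * u p.2, fun h => hu0 ?_, ?_⟩
    · ext b
      simpa using congrFun h (Fin.last n, b)
    · ext ⟨i, a⟩
      induction i using Fin.cases with
      | zero =>
        rw [companion_map_mulVec_zero]
        simp only [hu, Pi.smul_apply, smul_eq_mul, Fin.val_zero, Nat.sub_zero]
        ring
      | succ i =>
        rw [companion_map_mulVec_succ]
        simp only [Pi.smul_apply, smul_eq_mul, Fin.val_succ, Fin.val_castSucc]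
        rw [← mul_assoc, ← pow_succ']
        congr 2
        omega

theorem dotProduct_conj_mulVec {ι : Type*} [Fintype ι] (M P : Matrix ι ι ℝ) (x : ι → ℝ) :
    x ⬝ᵥ ((M * P * Mᵀ) *ᵥ x) = (x ᵥ* M) ⬝ᵥ (P *ᵥ (x ᵥ* M)) := by
  rw [← Matrix.mulVec_mulVec, ← Matrix.mulVec_mulVec, Matrix.dotProduct_mulVec,
    Matrix.mulVec_transpose]

/-- The block diagonal matrix with top-left block `C` and zeros elsewhere. -/
def topLeftBlock (n : ℕ) (C : Matrix (Fin m) (Fin m) ℝ) :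
    Matrix (Fin (n + 1) × Fin m) (Fin (n + 1) × Fin m) ℝ :=
  Matrix.of fun p q => if p.1 = 0 ∧ q.1 = 0 then C p.2 q.2 else 0

theorem dotProduct_topLeftBlock_mulVec (C : Matrix (Fin m) (Fin m) ℝ)
    (x : Fin (n + 1) × Fin m → ℝ) :
    x ⬝ᵥ (topLeftBlock n C *ᵥ x) = (fun a => x (0, a)) ⬝ᵥ (C *ᵥ fun a => x (0, a)) := by
  simp [topLeftBlock, Matrix.mulVec, dotProduct, Fintype.sum_prod_type, Fin.sum_univ_succ]

theorem Matrix.PosSemidef.topLeftBlock {C : Matrix (Fin m) (Fin m) ℝ} (hC : C.PosSemidef) :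
    (topLeftBlock n C).PosSemidef := by
  refine Matrix.PosSemidef.of_dotProduct_mulVec_nonneg ?_ fun x => ?_
  · ext p q
    have := hC.isHermitian.apply p.2 q.2
    simp only [star_trivial] at this
    simp [_root_.topLeftBlock, Matrix.conjTranspose_apply, this, and_comm]
  · rw [star_trivial, dotProduct_topLeftBlock_mulVec]
    exact hC.dotProduct_mulVec_nonneg _

/-- A solution of the Stein equation with right-hand side `topLeftBlock n C` is definite. -/
theorem posDef_of_companion_stein {C : Matrix (Fin m) (Fin m) ℝ} (hC : C.PosDef)
    {P : Matrix (Fin (n + 1) × Fin m) (Fin (n + 1) × Fin m) ℝ} (hP : P.PosSemidef)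
    (hstein : P = topLeftBlock n C + companion A * P * (companion A)ᵀ) : P.PosDef := by
  have hform : ∀ x, x ⬝ᵥ (P *ᵥ x) = (fun a => x (0, a)) ⬝ᵥ (C *ᵥ fun a => x (0, a)) +
      (x ᵥ* companion A) ⬝ᵥ (P *ᵥ (x ᵥ* companion A)) := fun x => by
    conv_lhs => rw [hstein]
    rw [Matrix.add_mulVec, dotProduct_add, dotProduct_topLeftBlock_mulVec, dotProduct_conj_mulVec]
  have hnn : ∀ x, 0 ≤ x ⬝ᵥ (P *ᵥ x) := fun x => hP.dotProduct_mulVec_nonneg x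
  have hker : ∀ x, x ⬝ᵥ (P *ᵥ x) = 0 → (∀ a, x (0, a) = 0) ∧
      (x ᵥ* companion A) ⬝ᵥ (P *ᵥ (x ᵥ* companion A)) = 0 := by
    intro x hx
    have h1 : 0 ≤ (fun a => x (0, a)) ⬝ᵥ (C *ᵥ fun a => x (0, a)) :=
      hC.posSemidef.dotProduct_mulVec_nonneg _
    have h2 := hnn (x ᵥ* companion A)
    have h3 := hform x
    refine ⟨?_, by linarith⟩
    by_contra hne
    have : (fun a => x (0, a)) ≠ 0 := fun h => hne (congrFun h)
    have h4 := hC.dotProduct_mulVec_pos this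
    rw [star_trivial] at h4
    linarith
  have hzero : ∀ (i : Fin (n + 1)) x, x ⬝ᵥ (P *ᵥ x) = 0 → ∀ a, x (i, a) = 0 := by
    intro i
    induction i using Fin.induction with
    | zero => exact fun x hx => (hker x hx).1
    | succ i ih =>
      intro x hx a
      rw [← vecMul_companion_castSucc A x (hker x hx).1]
      exact ih _ (hker x hx).2 a
  refine Matrix.PosDef.of_dotProduct_mulVec_pos hP.isHermitian fun x hx => ?_
  rw [star_trivial]
  exact (hnn x).lt_of_ne' fun h => hx (by ext ⟨i, a⟩; exact hzero i x h a)

end Companion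

section Toeplitz

variable {m n : ℕ}

theorem blockToeplitz_succ_succ (U : ℕ → Matrix (Fin m) (Fin m) ℝ) (i j : Fin n) (a b : Fin m) :
    blockToeplitz U (n + 1) (i.succ, a) (j.succ, b) =
      blockToeplitz U (n + 1) (i.castSucc, a) (j.castSucc, b) := by
  simp [blockToeplitz]

theorem exists_blockToeplitz_eq {P : Matrix (Fin (n + 1) × Fin m) (Fin (n + 1) × Fin m) ℝ}
    (hsymm : P.IsSymm) (hshift : ∀ (i j : Fin n) (a b : Fin m),
      P (i.succ, a) (j.succ, b) = P (i.castSucc, a) (j.castSucc, b)) :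
    ∃ U : ℕ → Matrix (Fin m) (Fin m) ℝ,
      blockToeplitz U (n + 1) = P ∧ ∀ a b, U 0 a b = P (0, a) (0, b) := by
  let U : ℕ → Matrix (Fin m) (Fin m) ℝ := fun t =>
    Matrix.of fun a b => if h : t < n + 1 then P (0, a) (⟨t, h⟩, b) else 0
  have hupper : ∀ (i j : ℕ) (hi : i < n + 1) (hj : j < n + 1), i ≤ j → ∀ a b,
      U (j - i) a b = P (⟨i, hi⟩, a) (⟨j, hj⟩, b) := by
    intro i
    induction i with
    | zero =>
      intro j _ hj _ a b
      exact dif_pos hj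
    | succ i ih =>
      intro j hi hj hij a b
      obtain ⟨j, rfl⟩ : ∃ j', j = j' + 1 := ⟨j - 1, by omega⟩
      rw [Nat.add_sub_add_right, ih j (by omega) (by omega) (by omega)]
      exact (hshift ⟨i, by omega⟩ ⟨j, by omega⟩ a b).symm
  refine ⟨U, ?_, fun a b => by simp [U]⟩
  ext ⟨i, a⟩ ⟨j, b⟩
  simp only [blockToeplitz, Matrix.of_apply]
  split_ifs with h
  · exact hupper i j i.2 j.2 h a b
  · rw [hupper j i j.2 i.2 (by omega) b a]
    exact hsymm.apply _ _

end Toeplitz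

theorem Matrix.PosSemidef.apply_eq_zero_of_diag_eq_zero {ι : Type*} [Fintype ι] [DecidableEq ι]
    {S : Matrix ι ι ℝ} (hS : S.PosSemidef) {p : ι} (hp : S p p = 0) (q : ι) : S q p = 0 := by
  have h := (hS.dotProduct_mulVec_zero_iff (Pi.single p 1)).1 (by simp [hp])
  simpa using congrFun h q

theorem schurStablePoly_of_stein {m n : ℕ} (A : Fin (n + 1) → Matrix (Fin m) (Fin m) ℝ)
    (U : ℕ → Matrix (Fin m) (Fin m) ℝ) (hU : (blockToeplitz U (n + 1)).PosDef)
    (hS : (blockToeplitz U (n + 1) -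
      companion A * blockToeplitz U (n + 1) * (companion A)ᵀ).PosSemidef)
    (hC : (U 0 - coeffRow A * blockToeplitz U (n + 1) * (coeffRow A)ᵀ).PosDef) :
    SchurStablePoly A := by
  intro z hz
  set P := blockToeplitz U (n + 1) with hPdef
  set C := U 0 - coeffRow A * P * (coeffRow A)ᵀ with hCdef
  have hSeq : P - companion A * P * (companion A)ᵀ = topLeftBlock n C := by
    have hdiag : ∀ (i : Fin n) a,
        (P - companion A * P * (companion A)ᵀ) (i.succ, a) (i.succ, a) = 0 := by
      intro i a
      rw [Matrix.sub_apply, companion_conj_succ, hPdef, blockToeplitz_succ_succ, sub_self]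
    ext ⟨i, a⟩ ⟨j, b⟩
    induction j using Fin.cases with
    | succ j => simp [hS.apply_eq_zero_of_diag_eq_zero (hdiag j b), topLeftBlock]
    | zero =>
      induction i using Fin.cases with
      | succ i =>
        have h := hS.apply_eq_zero_of_diag_eq_zero (hdiag i a) (0, b)
        rw [← hS.isHermitian.apply, h]
        simp [topLeftBlock]
      | zero =>
        rw [Matrix.sub_apply, companion_conj_zero]
        simp [topLeftBlock, hCdef, hPdef, blockToeplitz]
  rw [← mem_spectrum_companion_iff, mem_spectrum_iff_exists_vecMul] at hz
  obtain ⟨x, hx0, hx⟩ := hz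
  let a : Fin (n + 1) × Fin m → ℝ := fun p => (x p).re
  let b : Fin (n + 1) × Fin m → ℝ := fun p => (x p).im
  have ha : a ᵥ* companion A = z.re • a - z.im • b := by
    ext q
    have h := congrArg Complex.re (congrFun hx q)
    simpa [Matrix.vecMul, dotProduct, Complex.re_sum] using h
  have hb : b ᵥ* companion A = z.re • b + z.im • a := by
    ext q
    have h := congrArg Complex.im (congrFun hx q)
    simpa [Matrix.vecMul, dotProduct, Complex.im_sum] using h
  have hform : ∀ y, y ⬝ᵥ (P *ᵥ y) - (y ᵥ* companion A) ⬝ᵥ (P *ᵥ (y ᵥ* companion A)) =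
      (fun c => y (0, c)) ⬝ᵥ (C *ᵥ fun c => y (0, c)) := fun y => by
    rw [← dotProduct_topLeftBlock_mulVec, ← hSeq, Matrix.sub_mulVec, dotProduct_sub,
      dotProduct_conj_mulVec]
  have hPnn : ∀ y, 0 ≤ y ⬝ᵥ (P *ᵥ y) := fun y => hU.posSemidef.dotProduct_mulVec_nonneg y
  have hCnn : ∀ y, 0 ≤ y ⬝ᵥ (C *ᵥ y) := fun y => hC.posSemidef.dotProduct_mulVec_nonneg y
  have hCpos : ∀ y, y ≠ 0 → 0 < y ⬝ᵥ (C *ᵥ y) := fun y hy => hC.dotProduct_mulVec_pos hy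
  have hfirst : (fun c => a (0, c)) ≠ 0 ∨ (fun c => b (0, c)) ≠ 0 := by
    by_contra! hcon
    have ha0 : ∀ c, a (0, c) = 0 := congrFun hcon.1
    have hb0 : ∀ c, b (0, c) = 0 := congrFun hcon.2
    have hall : ∀ i : Fin (n + 1), ∀ c, a (i, c) = 0 ∧ b (i, c) = 0 := by
      intro i
      induction i using Fin.induction with
      | zero => exact fun c => ⟨ha0 c, hb0 c⟩
      | succ i ih =>
        intro c
        rw [← vecMul_companion_castSucc A a ha0, ← vecMul_companion_castSucc A b hb0, ha, hb]
        simp [ih c]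
    refine hx0 (funext fun ⟨i, c⟩ => Complex.ext (hall i c).1 (hall i c).2)
  have hpos : 0 < (fun c => a (0, c)) ⬝ᵥ (C *ᵥ fun c => a (0, c)) +
      (fun c => b (0, c)) ⬝ᵥ (C *ᵥ fun c => b (0, c)) := by
    rcases hfirst with h | h
    · exact add_pos_of_pos_of_nonneg (hCpos _ h) (hCnn _)
    · exact add_pos_of_nonneg_of_pos (hCnn _) (hCpos _ h)
  have hscale : (1 - ‖z‖ ^ 2) * (a ⬝ᵥ (P *ᵥ a) + b ⬝ᵥ (P *ᵥ b)) =
      (fun c => a (0, c)) ⬝ᵥ (C *ᵥ fun c => a (0, c)) +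
      (fun c => b (0, c)) ⬝ᵥ (C *ᵥ fun c => b (0, c)) := by
    rw [← hform a, ← hform b, ha, hb, Complex.sq_norm, Complex.normSq_apply]
    simp only [Matrix.mulVec_sub, Matrix.mulVec_add, Matrix.mulVec_smul, dotProduct_sub,
      dotProduct_add, sub_dotProduct, add_dotProduct, dotProduct_smul, smul_dotProduct, smul_eq_mul]
    ring
  rw [← hscale] at hpos
  have := pos_of_mul_pos_left hpos (add_nonneg (hPnn a) (hPnn b))
  nlinarith [norm_nonneg z]

theorem exists_stein_of_schurStablePoly {m n : ℕ} (A : Fin (n + 1) → Matrix (Fin m) (Fin m) ℝ)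
    (hA : SchurStablePoly A) :
    ∃ U : ℕ → Matrix (Fin m) (Fin m) ℝ, (U 0).IsSymm ∧
      (blockToeplitz U (n + 1)).PosDef ∧
      (blockToeplitz U (n + 1) -
        companion A * blockToeplitz U (n + 1) * (companion A)ᵀ).PosSemidef ∧
      (U 0 - coeffRow A * blockToeplitz U (n + 1) * (coeffRow A)ᵀ).PosDef := by
  have hQ : (topLeftBlock n (1 : Matrix (Fin m) (Fin m) ℝ)).PosSemidef :=
    Matrix.PosSemidef.one.topLeftBlock
  obtain ⟨P, hP, hstein⟩ := exists_posSemidef_stein (companion A) _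
    (fun z hz => hA z ((mem_spectrum_companion_iff A z).1 hz)) hQ
  have hsymm : P.IsSymm := by simpa [Matrix.IsHermitian, Matrix.IsSymm] using hP.isHermitian
  obtain ⟨U, hU, hU0⟩ := exists_blockToeplitz_eq hsymm fun i j a b => by
    conv_lhs => rw [hstein]
    rw [Matrix.add_apply, companion_conj_succ]
    simp [topLeftBlock]
  have hC : U 0 - coeffRow A * P * (coeffRow A)ᵀ = 1 := by
    ext a b
    rw [Matrix.sub_apply, hU0, ← companion_conj_zero, ← Matrix.sub_apply, sub_eq_of_eq_add hstein]
    simp [topLeftBlock]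
  refine ⟨U, ?_, ?_, ?_, ?_⟩
  · ext a b
    rw [Matrix.transpose_apply, hU0, hU0]
    exact hsymm.apply _ _
  · rw [hU]
    exact posDef_of_companion_stein A Matrix.PosDef.one hP hstein
  · rw [hU, sub_eq_of_eq_add hstein]
    exact hQ
  · rw [hU, hC]
    exact Matrix.PosDef.one

theorem schurStablePoly_iff_generalized_stein {m k : ℕ}
    (A : Fin k → Matrix (Fin m) (Fin m) ℝ) :
    SchurStablePoly A ↔
      ∃ U : ℕ → Matrix (Fin m) (Fin m) ℝ, (U 0).IsSymm ∧
        (blockToeplitz U k).PosDef ∧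
        (blockToeplitz U k - companion A * blockToeplitz U k * (companion A)ᵀ).PosSemidef ∧
        (U 0 - coeffRow A * blockToeplitz U k * (coeffRow A)ᵀ).PosDef := by
  cases k with
  | zero =>
    refine iff_of_true (fun z hz => by simp at hz) ⟨fun _ => 1, Matrix.isSymm_one, ?_, ?_, ?_⟩
    · rw [Subsingleton.elim (blockToeplitz _ 0) 1]
      exact Matrix.PosDef.one
    · rw [Subsingleton.elim (_ - _) 0]
      exact Matrix.PosSemidef.zero
    · have h : coeffRow A = 0 := by ext r q; exact q.1.elim0
      rw [h, Matrix.zero_mul, Matrix.zero_mul, sub_zero]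
      exact Matrix.PosDef.one
  | succ n =>
    exact ⟨exists_stein_of_schurStablePoly A,
      fun ⟨U, _, hU, hS, hC⟩ => schurStablePoly_of_stein A U hU hS hC⟩
end
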